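/- Every vector configuration V in a finite-dimensional real vector space E with dim E ≥ 1 has a subfamily W with rank(W) ≤ 2·disc(V), disc(W) = disc(V), and disc(V∖W) = 0, where V∖W is the complementary subfamily of V in E. -/

import Mathlib

open scoped Classical

noncomputable section

variable {E : Type*} [AddCommGroup E] [Module ℝ E] {ι : Type*} [Fintype ι]

/-- Number of indices where the functional is positive. -/
def posCount (φ : E →ₗ[ℝ] ℝ) (V : ι → E) : ℕ :=
  (Finset.univ.filter fun i => 0 < φ (V i)).card

/-- Number of indices where the functional is negative. -/
def negCount (φ : E →ₗ[ℝ] ℝ) (V : ι → E) : ℕ :=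
  (Finset.univ.filter fun i => φ (V i) < 0).card

/-- Number of indices where the functional is nonpositive. -/
def nonposCount (φ : E →ₗ[ℝ] ℝ) (V : ι → E) : ℕ :=
  (Finset.univ.filter fun i => φ (V i) ≤ 0).card

/-- Dual codegree: minimum over nonzero functionals of `nonposCount`; by convention the
number of elements when the ambient space is zero-dimensional (trivial). -/
def codegStar (V : ι → E) : ℕ :=
  if Nontrivial E then
    sInf {k | ∃ φ : E →ₗ[ℝ] ℝ, φ ≠ 0 ∧ nonposCount φ V = k}
  else Fintype.card ι

/-- Rank of a configuration: dimension of the linear span. -/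
def confRank (V : ι → E) : ℕ :=
  Module.finrank ℝ (Submodule.span ℝ (Set.range V))

/-- Dual degree: maximum over nonzero functionals of `posCount`, minus the rank. -/
def degStar (V : ι → E) : ℤ :=
  (sSup {k | ∃ φ : E →ₗ[ℝ] ℝ, φ ≠ 0 ∧ posCount φ V = k} : ℕ) - (confRank V : ℤ)

/-- Covector discrepancy: maximum over all functionals of `|φ⁺(V) − φ⁻(V)|`. -/
def disc (V : ι → E) : ℕ :=
  sSup {k | ∃ φ : E →ₗ[ℝ] ℝ, k = ((posCount φ V : ℤ) - (negCount φ V : ℤ)).natAbs}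

/-- The subfamily of `V` indexed by `S`. -/
def subfam (V : ι → E) (S : Finset ι) : {i // i ∈ S} → E := fun i => V i.1

/-- The contraction `V/W`, where `W = V|S`: images of the remaining vectors in the
quotient by the span of `W`. -/
def contract (V : ι → E) (S : Finset ι) :
    {i // i ∉ S} → E ⧸ Submodule.span ℝ (V '' (S : Set ι)) :=
  fun i => Submodule.Quotient.mk (V i.1)

/-- `V|S` is linearly closed in `V`. -/
def LinClosed (V : ι → E) (S : Finset ι) : Prop :=
  ∀ i, V i ∈ Submodule.span ℝ (V '' (S : Set ι)) → i ∈ S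

/-- A codegree* decomposition of `V` of length `m`: a partition of the index set into
parts `S 0, S 1, …, S m` with `codegStar (V|S i) ≥ 1` for `i ≠ 0` and
`codegStar V = ∑_{i=1}^m codegStar (V|S i)`. -/
def IsCodegDecomp (V : ι → E) (m : ℕ) (S : Fin (m + 1) → Finset ι) : Prop :=
  (∀ i j, i ≠ j → Disjoint (S i) (S j)) ∧
  (∀ x, ∃ i, x ∈ S i) ∧
  (∀ i, i ≠ 0 → 1 ≤ codegStar (subfam V (S i))) ∧
  codegStar V = ∑ i ∈ Finset.univ.erase (0 : Fin (m + 1)), codegStar (subfam V (S i))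


/-- Signed count of a functional on the subfamily indexed by `T`. -/
def sgnSum {Q : Type*} [AddCommGroup Q] [Module ℝ Q] {κ : Type*} (W : κ → Q) (T : Finset κ)
    (φ : Q →ₗ[ℝ] ℝ) : ℤ :=
  ∑ i ∈ T, ((SignType.sign (φ (W i)) : SignType) : ℤ)

section aux
variable {Q : Type*} [AddCommGroup Q] [Module ℝ Q] {κ : Type*}

theorem sgnSum_neg (W : κ → Q) (T : Finset κ) (φ : Q →ₗ[ℝ] ℝ) :
    sgnSum W T (-φ) = - sgnSum W T φ := by
  unfold sgnSum
  rw [← Finset.sum_neg_distrib]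
  refine Finset.sum_congr rfl fun i _ => ?_
  rw [LinearMap.neg_apply, Left.sign_neg]
  simp

/-- A functional vanishing on `F` and on no further vector of the family. -/
theorem exists_generic (W : κ → Q) (T : Finset κ) (F : Submodule ℝ Q) :
    ∃ φ : Q →ₗ[ℝ] ℝ, (∀ x ∈ F, φ x = 0) ∧ ∀ i ∈ T, φ (W i) = 0 → W i ∈ F := by
  haveI : Finite {i // i ∈ T ∧ W i ∉ F} :=
    Finite.of_injective (fun i => (⟨i.1, i.2.1⟩ : {i // i ∈ T})) fun x y h =>
      Subtype.ext (congrArg (fun z : {i // i ∈ T} => z.1) h)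
  obtain ⟨g, hg⟩ := Module.exists_dual_forall_apply_ne_zero (K := ℝ)
    (fun i : {i // i ∈ T ∧ W i ∉ F} => F.mkQ (W i.1)) (by
      rintro ⟨i, hi, hF⟩ h
      exact hF (by simpa using h))
  refine ⟨g ∘ₗ F.mkQ, fun x hx => ?_, fun i hi h => ?_⟩
  · have : F.mkQ x = 0 := by simpa using hx
    simp only [LinearMap.comp_apply, this, map_zero]
  · by_contra hF
    exact hg ⟨i, hi, hF⟩ h

theorem perturb (W : κ → Q) (T : Finset κ) (φ ψ : Q →ₗ[ℝ] ℝ) :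
    ∃ ε : ℝ, 0 < ε ∧
      sgnSum W T (φ + ε • ψ) = sgnSum W T φ + sgnSum W (T.filter fun i => φ (W i) = 0) ψ := by
  have h : ∀ᶠ ε : ℝ in nhdsWithin 0 (Set.Ioi 0), ∀ i ∈ T, φ (W i) ≠ 0 →
      SignType.sign (φ (W i) + ε * ψ (W i)) = SignType.sign (φ (W i)) := by
    rw [Filter.eventually_all_finset]
    intro i _
    by_cases h0 : φ (W i) = 0
    · simp [h0]
    · have hc : Filter.Tendsto (fun ε : ℝ => φ (W i) + ε * ψ (W i)) (nhdsWithin 0 (Set.Ioi 0))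
          (nhds (φ (W i))) := by
        have : Continuous (fun ε : ℝ => φ (W i) + ε * ψ (W i)) := by fun_prop
        have h2 := this.tendsto 0
        simp only [zero_mul, add_zero] at h2
        exact h2.mono_left nhdsWithin_le_nhds
      rcases lt_or_gt_of_ne h0 with hl | hl
      · filter_upwards [hc.eventually (gt_mem_nhds hl)] with ε hε _
        rw [sign_neg hε, sign_neg hl]
      · filter_upwards [hc.eventually (lt_mem_nhds hl)] with ε hε _
        rw [sign_pos hε, sign_pos hl]
  obtain ⟨ε, hε, hpos⟩ := (h.and self_mem_nhdsWithin).exists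
  have hpos : 0 < ε := hpos
  refine ⟨ε, hpos, ?_⟩
  unfold sgnSum
  rw [Finset.sum_filter, ← Finset.sum_add_distrib]
  refine Finset.sum_congr rfl fun i hi => ?_
  by_cases h0 : φ (W i) = 0
  · simp [h0, sign_mul, sign_pos hpos]
  · rw [if_neg h0]
    simp [hε i hi h0]

theorem exists_dual_zero_pos {a b : Q} (h : b ∉ Submodule.span ℝ {a}) :
    ∃ ψ : Q →ₗ[ℝ] ℝ, ψ a = 0 ∧ ψ b = 1 := by
  obtain ⟨f, hf, hk⟩ := Submodule.exists_le_ker_of_notMem h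
  have ha : f a = 0 := hk (Submodule.mem_span_singleton_self a)
  exact ⟨(f b)⁻¹ • f, by simp [ha], by simp [hf]⟩

/-- Planar step. -/
theorem pair_step (W : κ → Q) (T : Finset κ)
    (h1 : ∀ i ∈ T, ∀ j ∈ T, ∀ c : ℝ, 0 < c → W i ≠ -(c • W j))
    (h2 : ∀ ψ : Q →ₗ[ℝ] ℝ, (∃ i ∈ T, ψ (W i) = 0) → sgnSum W T ψ = 0)
    {i j : κ} (hi : i ∈ T) (hj : j ∈ T) (hij : W j ∉ Submodule.span ℝ {W i})
    (hji : W i ∉ Submodule.span ℝ {W j}) :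
    ∃ k ∈ T, ∃ a b : ℝ, 0 < a ∧ 0 < b ∧ W k = -(a • W i + b • W j) := by
  obtain ⟨φ, hφ0, hφ⟩ := exists_generic W T (Submodule.span ℝ {W i, W j})
  have hφi : φ (W i) = 0 := hφ0 _ (Submodule.subset_span (by simp))
  have hφj : φ (W j) = 0 := hφ0 _ (Submodule.subset_span (by simp))
  obtain ⟨β, hβi, hβj⟩ := exists_dual_zero_pos hij
  obtain ⟨α, hαj, hαi⟩ := exists_dual_zero_pos hji
  have hf0 := h2 φ ⟨i, hi, hφi⟩
  have key : ∀ ψ : Q →ₗ[ℝ] ℝ, (∃ k ∈ T, φ (W k) = 0 ∧ ψ (W k) = 0) →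
      sgnSum W (T.filter fun i => φ (W i) = 0) ψ = 0 := by
    rintro ψ ⟨k, hk, hk0, hk1⟩
    obtain ⟨ε, -, he⟩ := perturb W T φ ψ
    rw [h2 _ ⟨k, hk, by simp [hk0, hk1]⟩, hf0] at he
    linarith
  have kα := key α ⟨j, hj, hφj, hαj⟩
  have kβ := key β ⟨i, hi, hφi, hβi⟩
  by_contra hcon
  have hpos : 0 < ∑ k ∈ T.filter (fun i => φ (W i) = 0),
      (((SignType.sign (α (W k)) : SignType) : ℤ) + ((SignType.sign (β (W k)) : SignType) : ℤ)) := by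
    refine Finset.sum_pos' ?_ ⟨i, by simp [hi, hφi], by simp [hαi, hβi]⟩
    intro k hk
    rw [Finset.mem_filter] at hk
    obtain ⟨a, b, hab⟩ := Submodule.mem_span_pair.1 (hφ k hk.1 hk.2)
    have ea : α (W k) = a := by rw [← hab]; simp [hαi, hαj]
    have eb : β (W k) = b := by rw [← hab]; simp [hβi, hβj]
    rw [ea, eb]
    rcases lt_trichotomy a 0 with ha | ha | ha <;> rcases lt_trichotomy b 0 with hb | hb | hb
    · exact absurd ⟨k, hk.1, -a, -b, by linarith, by linarith, by rw [← hab]; module⟩ hcon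
    · exact absurd (by rw [← hab, hb]; module) (h1 k hk.1 i hi (-a) (by linarith))
    · simp [sign_neg ha, sign_pos hb]
    · exact absurd (by rw [← hab, ha]; module) (h1 k hk.1 j hj (-b) (by linarith))
    · simp [ha, hb]
    · simp [ha, sign_pos hb]
    · simp [sign_pos ha, sign_neg hb]
    · simp [sign_pos ha, hb]
    · simp [sign_pos ha, sign_pos hb]
  rw [Finset.sum_add_distrib] at hpos
  unfold sgnSum at kα kβ
  omega

/-- Explicit linear independence of a triple. -/
def Ind3 (a b c : Q) : Prop :=
  ∀ x y z : ℝ, x • a + y • b + z • c = 0 → x = 0 ∧ y = 0 ∧ z = 0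

/-- Membership in the double cone. -/
def DCone (a b c w : Q) : Prop :=
  ∃ x y z : ℝ, 0 ≤ x ∧ 0 ≤ y ∧ 0 ≤ z ∧ (w = x • a + y • b + z • c ∨ w = -(x • a + y • b + z • c))

theorem Ind3.rot {a b c : Q} (h : Ind3 a b c) : Ind3 b c a := by
  intro x y z e
  have := h z x y (by rw [← e]; module)
  tauto

theorem Ind3.notMem {a b c : Q} (h : Ind3 a b c) : b ∉ Submodule.span ℝ {a} := by
  intro hm
  obtain ⟨t, ht⟩ := Submodule.mem_span_singleton.1 hm
  have := h t (-1) 0 (by rw [← ht]; module)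
  linarith [this.2.1]

theorem Ind3.notMem' {a b c : Q} (h : Ind3 a b c) : a ∉ Submodule.span ℝ {b} := by
  intro hm
  obtain ⟨t, ht⟩ := Submodule.mem_span_singleton.1 hm
  have := h (-1) t 0 (by rw [← ht]; module)
  linarith [this.1]

theorem no_triple (W : κ → Q) (T : Finset κ)
    (hs : ∀ i ∈ T, ∀ j ∈ T, W j ∉ Submodule.span ℝ {W i} → W i ∉ Submodule.span ℝ {W j} →
      ∃ k ∈ T, ∃ a b : ℝ, 0 < a ∧ 0 < b ∧ W k = -(a • W i + b • W j)) (n : ℕ) :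
    ∀ i ∈ T, ∀ j ∈ T, ∀ k ∈ T, Ind3 (W i) (W j) (W k) →
      (T.filter fun l => DCone (W i) (W j) (W k) (W l)).card = n → False := by
  induction n using Nat.strong_induction_on with
  | _ n ih =>
  intro i hi j hj k hk hind hn
  obtain ⟨p, hp, a, b, ha, hb, ep⟩ := hs i hi j hj hind.notMem hind.notMem'
  obtain ⟨q, hq, c, d, hc, hd, eq⟩ := hs j hj k hk hind.rot.notMem hind.rot.notMem'
  obtain ⟨r, hr, e, f, he, hf, er⟩ := hs k hk i hi hind.rot.rot.notMem hind.rot.rot.notMem'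
  have hind' : Ind3 (W p) (W q) (W r) := by
    intro x y z h
    rw [ep, eq, er] at h
    obtain ⟨h1, h2, h3⟩ := hind (x * a + z * f) (x * b + y * c) (y * d + z * e) (by
      have : -(x • -(a • W i + b • W j) + y • -(c • W j + d • W k) + z • -(e • W k + f • W i))
        = -0 := by rw [h]
      rw [neg_zero] at this
      rw [← this]; module)
    have hz : z = -(x * a) / f := by field_simp; linarith
    have hy : y = -(x * b) / c := by field_simp; linarith
    have hx : x = 0 := by
      rw [hz, hy] at h3
      field_simp at h3
      have h4 : x * (b * d * f + a * c * e) = 0 := by linarith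
      rcases mul_eq_zero.1 h4 with h | h
      · exact h
      · have : 0 < b * d * f + a * c * e := by positivity
        linarith
    subst hx
    simp at hz hy
    exact ⟨rfl, hy, hz⟩
  refine ih _ ?_ p hp q hq r hr hind' rfl
  rw [← hn]
  refine Finset.card_lt_card (Finset.ssubset_iff_of_subset ?_ |>.2 ⟨i, ?_, ?_⟩)
  · intro l hl
    rw [Finset.mem_filter] at hl ⊢
    refine ⟨hl.1, ?_⟩
    obtain ⟨x, y, z, hx, hy, hz, h⟩ := hl.2
    refine ⟨x * a + z * f, x * b + y * c, y * d + z * e, by positivity, by positivity,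
      by positivity, ?_⟩
    rw [ep, eq, er] at h
    rcases h with h | h
    · right; rw [h]; module
    · left; rw [h]; module
  · rw [Finset.mem_filter]
    exact ⟨hi, 1, 0, 0, by simp, by simp, by simp, by simp⟩
  · rw [Finset.mem_filter]
    rintro ⟨-, x, y, z, hx, hy, hz, h⟩
    rw [ep, eq, er] at h
    have main : ∀ s : ℝ, W i = s • (x • -(a • W i + b • W j) + y • -(c • W j + d • W k) +
        z • -(e • W k + f • W i)) → s = 1 ∨ s = -1 → False := by
      intro s h hs
      obtain ⟨h1, h2, h3⟩ := hind (1 + s * (x * a + z * f)) (s * (x * b + y * c))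
        (s * (y * d + z * e)) (by
          nth_rewrite 1 [add_smul]
          rw [one_smul]
          nth_rewrite 1 [h]
          module)
      have hs0 : s ≠ 0 := by rcases hs with h | h <;> rw [h] <;> norm_num
      have h2 := (mul_eq_zero.1 h2).resolve_left hs0
      have h3 := (mul_eq_zero.1 h3).resolve_left hs0
      have hx0 : x * b = 0 := le_antisymm (by nlinarith [mul_nonneg hy hc.le]) (by positivity)
      have hz0 : z * e = 0 := le_antisymm (by nlinarith [mul_nonneg hy hd.le]) (by positivity)
      have hx0 := (mul_eq_zero.1 hx0).resolve_right hb.ne'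
      have hz0 := (mul_eq_zero.1 hz0).resolve_right he.ne'
      rw [hx0, hz0] at h1
      simp at h1
    rcases h with h | h
    · exact main 1 (by rw [one_smul]; exact h) (Or.inl rfl)
    · exact main (-1) (by rw [neg_one_smul]; exact h) (Or.inr rfl)

theorem rank_le_two [FiniteDimensional ℝ Q] (W : κ → Q) (T : Finset κ)
    (h1 : ∀ i ∈ T, ∀ j ∈ T, ∀ c : ℝ, 0 < c → W i ≠ -(c • W j))
    (h2 : ∀ ψ : Q →ₗ[ℝ] ℝ, (∃ i ∈ T, ψ (W i) = 0) → sgnSum W T ψ = 0) :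
    Module.finrank ℝ (Submodule.span ℝ (W '' (T : Set κ))) ≤ 2 := by
  by_contra hcon
  obtain ⟨f, hf, -, hli⟩ := Submodule.exists_fun_fin_finrank_span_eq ℝ (W '' (T : Set κ))
  have h3 : 3 ≤ Module.finrank ℝ (Submodule.span ℝ (W '' (T : Set κ))) := by omega
  have hl3 := hli.comp (Fin.castLE h3) (Fin.castLE_injective h3)
  obtain ⟨i, hi, ei⟩ := hf (Fin.castLE h3 0)
  obtain ⟨j, hj, ej⟩ := hf (Fin.castLE h3 1)
  obtain ⟨k, hk, ek⟩ := hf (Fin.castLE h3 2)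
  refine no_triple W T (fun i hi j hj => pair_step W T h1 h2 hi hj) _ i hi j hj k hk ?_ rfl
  intro x y z h
  have := Fintype.linearIndependent_iff.1 hl3 ![x, y, z] (by
    simp only [Fin.sum_univ_three, Function.comp_apply, ← ei, ← ej, ← ek]
    simpa using h)
  exact ⟨this 0, this 1, this 2⟩

/-- Reducing a family: a subfamily with the same signed counts (on functionals from `X`). -/
theorem exists_reduced (W : κ → Q) (S : Finset κ) :
    ∃ T ⊆ S, (∀ ψ, sgnSum W T ψ = sgnSum W S ψ) ∧ (∀ i ∈ T, W i ≠ 0) ∧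
      ∀ i ∈ T, ∀ j ∈ T, ∀ c : ℝ, 0 < c → W i ≠ -(c • W j) := by
  obtain ⟨T, hT, hmin⟩ := Finset.exists_min_image
    (S.powerset.filter fun T => ∀ ψ, sgnSum W T ψ = sgnSum W S ψ) Finset.card
    ⟨S, by simp⟩
  simp only [Finset.mem_filter, Finset.mem_powerset] at hT hmin
  have hz : ∀ i ∈ T, W i ≠ 0 := by
    intro i hi h0
    have := hmin (T.erase i) ⟨(Finset.erase_subset _ _).trans hT.1, fun ψ => by
      rw [← hT.2 ψ]
      unfold sgnSum
      rw [← Finset.add_sum_erase T _ hi]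
      simp [h0]⟩
    exact absurd (Finset.card_erase_lt_of_mem hi) (by omega)
  refine ⟨T, hT.1, hT.2, hz, ?_⟩
  intro i hi j hj c hc h
  have hij : j ≠ i := by
    rintro rfl
    apply hz j hj
    have : (1 + c) • W j = 0 := by
      rw [add_smul, one_smul]; nth_rewrite 1 [h]; module
    exact (smul_eq_zero.1 this).resolve_left (by positivity)
  have hj' : j ∈ T.erase i := Finset.mem_erase.2 ⟨hij, hj⟩
  have := hmin ((T.erase i).erase j)
    ⟨((Finset.erase_subset _ _).trans (Finset.erase_subset _ _)).trans hT.1, fun ψ => by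
      rw [← hT.2 ψ]
      unfold sgnSum
      rw [← Finset.add_sum_erase T _ hi, ← Finset.add_sum_erase _ _ hj', h]
      simp [Left.sign_neg, sign_mul, sign_pos hc]⟩
  have l1 := Finset.card_erase_lt_of_mem hi
  have l2 := Finset.card_erase_lt_of_mem hj'
  omega

/-- A reduced nonempty family has a functional with positive signed count. -/
theorem exists_pos (W : κ → Q) (S : Finset κ) (hne : S.Nonempty) (hz : ∀ i ∈ S, W i ≠ 0)
    (ha : ∀ i ∈ S, ∀ j ∈ S, ∀ c : ℝ, 0 < c → W i ≠ -(c • W j)) :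
    ∃ φ, 1 ≤ sgnSum W S φ := by
  obtain ⟨i, hi⟩ := hne
  obtain ⟨φ, hφ0, hφ⟩ := exists_generic W S (Submodule.span ℝ {W i})
  have hφi : φ (W i) = 0 := hφ0 _ (Submodule.mem_span_singleton_self _)
  have hn : W i ∉ Submodule.span ℝ {(0 : Q)} := by simpa using hz i hi
  obtain ⟨ψ, -, hψ⟩ := exists_dual_zero_pos hn
  have hpos : 0 < sgnSum W (S.filter fun i => φ (W i) = 0) ψ := by
    refine Finset.sum_pos' ?_ ⟨i, by simp [hi, hφi], by simp [hψ]⟩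
    intro k hk
    rw [Finset.mem_filter] at hk
    obtain ⟨t, ht⟩ := Submodule.mem_span_singleton.1 (hφ k hk.1 hk.2)
    have ht0 : 0 ≤ t := by
      by_contra hneg
      exact ha k hk.1 i hi (-t) (by linarith) (by rw [← ht]; module)
    have : 0 ≤ ψ (W k) := by rw [← ht]; simpa [hψ] using ht0
    rcases this.eq_or_lt with h | h
    · simp [← h]
    · simp [sign_pos h]
  obtain ⟨ε, -, he⟩ := perturb W S φ ψ
  by_cases h : 1 ≤ sgnSum W S φ
  · exact ⟨φ, h⟩
  by_cases h' : sgnSum W S φ = 0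
  · exact ⟨φ + ε • ψ, by omega⟩
  · exact ⟨-φ, by rw [sgnSum_neg]; omega⟩

/-- Rank of the subfamily indexed by `S`. -/
def rk (W : κ → Q) (S : Finset κ) : ℕ := Module.finrank ℝ (Submodule.span ℝ (W '' (S : Set κ)))

theorem exists_pos_rank [FiniteDimensional ℝ Q] (W : κ → Q) (S : Finset κ) (hne : S.Nonempty)
    (hz : ∀ i ∈ S, W i ≠ 0)
    (ha : ∀ i ∈ S, ∀ j ∈ S, ∀ c : ℝ, 0 < c → W i ≠ -(c • W j)) :
    ∃ φ, 1 ≤ sgnSum W S φ ∧ rk W S ≤ rk W (S.filter fun i => φ (W i) = 0) + 2 := by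
  obtain ⟨φ₀, hφ₀⟩ := exists_pos W S hne hz ha
  -- choose the zero set of maximal rank
  obtain ⟨Z, hZ, hmax⟩ := Finset.exists_max_image
    (S.powerset.filter fun Z => ∃ φ, 1 ≤ sgnSum W S φ ∧ Z = S.filter fun i => φ (W i) = 0)
    (rk W) ⟨S.filter fun i => φ₀ (W i) = 0, by
      simp only [Finset.mem_filter, Finset.mem_powerset]
      exact ⟨Finset.filter_subset _ _, φ₀, hφ₀, rfl⟩⟩
  simp only [Finset.mem_filter, Finset.mem_powerset] at hZ hmax
  obtain ⟨-, φ, hφ, rfl⟩ := hZ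
  refine ⟨φ, hφ, ?_⟩
  set F := Submodule.span ℝ (W '' ((S.filter fun i => φ (W i) = 0 : Finset κ) : Set κ)) with hF
  have hFφ : ∀ x ∈ F, φ x = 0 := by
    intro x hx
    have : F ≤ LinearMap.ker φ := by
      rw [hF, Submodule.span_le]
      rintro _ ⟨i, hi, rfl⟩
      simp at hi
      exact hi.2
    exact this hx
  have hvan : ∀ ψ : Q →ₗ[ℝ] ℝ, (∀ x ∈ F, ψ x = 0) → (∃ i ∈ S, W i ∉ F ∧ ψ (W i) = 0) →
      sgnSum W S ψ = 0 := by
    have pre : ∀ ψ : Q →ₗ[ℝ] ℝ, (∀ x ∈ F, ψ x = 0) → (∃ i ∈ S, W i ∉ F ∧ ψ (W i) = 0) →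
      ¬ 1 ≤ sgnSum W S ψ := by
      rintro ψ hψ ⟨i, hi, hiF, hi0⟩ h
      have := hmax _ ⟨Finset.filter_subset _ _, ψ, h, rfl⟩
      refine absurd (Submodule.finrank_lt_finrank_of_lt (K := ℝ) (s := F)
        (t := Submodule.span ℝ (W '' ((S.filter fun i => ψ (W i) = 0 : Finset κ) : Set κ))) ?_)
        (not_lt.2 this)
      refine lt_of_le_of_ne ?_ ?_
      · rw [hF, Submodule.span_le]
        rintro _ ⟨k, hk, rfl⟩
        refine Submodule.subset_span ⟨k, ?_, rfl⟩
        have := hψ (W k) (Submodule.subset_span ⟨k, hk, rfl⟩)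
        simp at hk ⊢
        exact ⟨hk.1, this⟩
      · intro e
        apply hiF
        rw [e]
        exact Submodule.subset_span ⟨i, by simp [hi, hi0], rfl⟩
    rintro ψ hψ ⟨i, hi, hiF, hi0⟩
    have p1 := pre ψ hψ ⟨i, hi, hiF, hi0⟩
    have p2 := pre (-ψ) (fun x hx => by simp [hψ x hx]) ⟨i, hi, hiF, by simp [hi0]⟩
    rw [sgnSum_neg] at p2
    omega
  obtain ⟨T, hTS, hT, hTz, hTa⟩ := exists_reduced (fun i => F.mkQ (W i)) S
  have hTz' : ∀ i ∈ T, W i ∉ F := by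
    intro i hi h
    exact hTz i hi (by simpa using h)
  have hr2 := rank_le_two (fun i => F.mkQ (W i)) T hTa (by
    rintro ψ ⟨i, hi, h⟩
    rw [hT]
    exact hvan (ψ ∘ₗ F.mkQ) (fun x hx => by
      have : F.mkQ x = 0 := by simpa using hx
      simp only [LinearMap.comp_apply, this, map_zero]) ⟨i, hTS hi, hTz' i hi, h⟩)
  -- all vectors of `S` lie in `G`
  set G := F ⊔ Submodule.span ℝ (W '' (T : Set κ)) with hG
  have hSG : ∀ i ∈ S, W i ∈ G := by
    intro i hi
    by_contra hiG
    obtain ⟨ψ, hψG, hψi⟩ := LinearMap.exists_extend_of_notMem (φ.domRestrict G) hiG 0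
    have agree : ∀ x ∈ G, ψ x = φ x := by
      intro x hx
      have := LinearMap.congr_fun hψG ⟨x, hx⟩
      simpa using this
    have hψF : ∀ x ∈ F, ψ x = 0 := fun x hx => by
      rw [agree x (le_sup_left (a := F) hx), hFφ x hx]
    have h0 := hvan ψ hψF ⟨i, hi, fun h => hiG (le_sup_left (a := F) h), hψi⟩
    have e1 : sgnSum W T ψ = sgnSum W S ψ := hT (F.liftQ ψ (fun x hx => hψF x hx))
    have e2 : sgnSum W T φ = sgnSum W S φ := hT (F.liftQ φ (fun x hx => hFφ x hx))
    have e3 : ∑ k ∈ T, ((SignType.sign (ψ (W k)) : SignType) : ℤ)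
        = ∑ k ∈ T, ((SignType.sign (φ (W k)) : SignType) : ℤ) := by
      refine Finset.sum_congr rfl fun k hk => ?_
      rw [agree (W k) (le_sup_right (a := F) (Submodule.subset_span ⟨k, hk, rfl⟩))]
    unfold sgnSum at h0 hφ e1 e2
    omega
  have hle : Submodule.span ℝ (W '' (S : Set κ)) ≤ G := by
    rw [Submodule.span_le]
    rintro _ ⟨i, hi, rfl⟩
    exact hSG i hi
  have r1 := Submodule.finrank_mono hle
  have e4 : Submodule.span ℝ ((fun i => F.mkQ (W i)) '' (T : Set κ)) = G.map F.mkQ := by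
    have : F.map F.mkQ = ⊥ := by simp
    rw [hG, Submodule.map_sup, this, bot_sup_eq, Submodule.map_span, ← Set.image_comp]
    rfl
  rw [e4] at hr2
  have r3 : Module.finrank ℝ G ≤ Module.finrank ℝ (G.map F.mkQ) + Module.finrank ℝ F := by
    have h := LinearMap.finrank_range_add_finrank_ker (F.mkQ.domRestrict G)
    rw [LinearMap.range_domRestrict, LinearMap.ker_domRestrict, Submodule.ker_mkQ] at h
    have : Module.finrank ℝ (F.comap G.subtype) ≤ Module.finrank ℝ F := by
      refine LinearMap.finrank_le_finrank_of_injective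
        (f := (G.subtype.restrict (p := F.comap G.subtype) (q := F) fun x hx => hx)) ?_
      intro x y hxy
      have := congrArg Subtype.val hxy
      simpa [LinearMap.restrict_apply] using this
    omega
  unfold rk
  rw [← hF]
  omega

theorem exists_half_rank [FiniteDimensional ℝ Q] (W : κ → Q) (n : ℕ) :
    ∀ S : Finset κ, S.card = n → (∀ i ∈ S, W i ≠ 0) →
      (∀ i ∈ S, ∀ j ∈ S, ∀ c : ℝ, 0 < c → W i ≠ -(c • W j)) →
      ∃ φ, (rk W S : ℤ) ≤ 2 * sgnSum W S φ := by
  induction n using Nat.strong_induction_on with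
  | _ n ih =>
  intro S hn hz ha
  rcases S.eq_empty_or_nonempty with rfl | hne
  · exact ⟨0, by simp [rk, sgnSum]⟩
  obtain ⟨φ, h1, hr⟩ := exists_pos_rank W S hne hz ha
  have hlt : (S.filter fun i => φ (W i) = 0).card < n := by
    rw [← hn]
    refine Finset.card_lt_card (Finset.filter_ssubset.2 ?_)
    by_contra hcon
    push Not at hcon
    have : sgnSum W S φ = 0 := Finset.sum_eq_zero fun i hi => by simp [hcon i hi]
    omega
  obtain ⟨ψ, hψ⟩ := ih _ hlt (S.filter fun i => φ (W i) = 0) rfl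
    (fun i hi => hz i (Finset.mem_filter.1 hi).1)
    (fun i hi j hj => ha i (Finset.mem_filter.1 hi).1 j (Finset.mem_filter.1 hj).1)
  obtain ⟨ε, -, he⟩ := perturb W S φ ψ
  exact ⟨φ + ε • ψ, by omega⟩

theorem count_eq [Fintype κ] (W : κ → Q) (φ : Q →ₗ[ℝ] ℝ) :
    (posCount φ W : ℤ) - (negCount φ W : ℤ) = sgnSum W Finset.univ φ := by
  unfold posCount negCount sgnSum
  rw [Finset.card_filter, Finset.card_filter]
  push_cast
  rw [← Finset.sum_sub_distrib]
  refine Finset.sum_congr rfl fun i _ => ?_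
  rcases lt_trichotomy (φ (W i)) 0 with h | h | h
  · simp [h, h.le]
  · simp [h]
  · simp [h, h.le]

theorem disc_eq [Fintype κ] (W : κ → Q) :
    disc W = sSup {k | ∃ φ : Q →ₗ[ℝ] ℝ, k = (sgnSum W Finset.univ φ).natAbs} := by
  unfold disc
  simp only [count_eq]

theorem le_disc [Fintype κ] (W : κ → Q) (φ : Q →ₗ[ℝ] ℝ) :
    (sgnSum W Finset.univ φ).natAbs ≤ disc W := by
  rw [disc_eq]
  refine le_csSup ⟨Fintype.card κ, ?_⟩ ⟨φ, rfl⟩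
  rintro _ ⟨ψ, rfl⟩
  rw [← count_eq]
  have h1 : posCount ψ W ≤ Fintype.card κ := Finset.card_le_univ _
  have h2 : negCount ψ W ≤ Fintype.card κ := Finset.card_le_univ _
  omega

end aux

/-- every configuration has a subfamily `W` with
`rank W ≤ 2·disc V`, `disc W = disc V` and `disc (V∖W) = 0`. -/
theorem exists_small_rank_subfam_carrying_disc {E : Type*} [AddCommGroup E] [Module ℝ E]
    [FiniteDimensional ℝ E] (hE : 1 ≤ Module.finrank ℝ E)
    {ι : Type*} [Fintype ι] (V : ι → E) :
    ∃ S : Finset ι, confRank (subfam V S) ≤ 2 * disc V ∧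
      disc (subfam V S) = disc V ∧
      disc (fun i : {i // i ∉ S} => V i.1) = 0 := by
  obtain ⟨S, -, hS, hz, ha⟩ := exists_reduced V Finset.univ
  have hsub : ∀ φ : E →ₗ[ℝ] ℝ, sgnSum (subfam V S) Finset.univ φ = sgnSum V S φ := by
    intro φ
    unfold sgnSum subfam
    exact Finset.sum_coe_sort S (fun i => ((SignType.sign (φ (V i)) : SignType) : ℤ))
  have hcompl : ∀ φ : E →ₗ[ℝ] ℝ,
      sgnSum (fun i : {i // i ∉ S} => V i.1) Finset.univ φ = 0 := by
    intro φ
    have h := hS φ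
    unfold sgnSum at h ⊢
    have h2 := Finset.sum_add_sum_compl S
      (fun i => ((SignType.sign (φ (V i)) : SignType) : ℤ))
    rw [← Finset.sum_subtype (p := fun i => i ∉ S) Sᶜ (by simp)
      (fun i => ((SignType.sign (φ (V i)) : SignType) : ℤ))]
    linarith
  refine ⟨S, ?_, ?_, ?_⟩
  · obtain ⟨φ, hφ⟩ := exists_half_rank V _ S rfl hz ha
    have h1 := le_disc V φ
    rw [← hS] at h1
    have : confRank (subfam V S) = rk V S := by
      unfold confRank rk
      have : Set.range (subfam V S) = V '' (S : Set ι) := by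
        ext x; simp [subfam]
      rw [this]
    omega
  · rw [disc_eq, disc_eq]
    simp only [hsub, hS]
  · rw [disc_eq]
    simp only [hcompl]
    simp

end
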